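/- Let f : ℝ^d → ℝ be differentiable with G-bounded gradient and L-smooth, and let g be a stochastic gradient oracle for f with variance σ² on a probability space (Ω, P). Let 0 < η ≤ 1/L and ρ > 0, let w ∈ ℝ^d with ∇f(w) ≠ 0, and define the one-step SAM update w⁺(ω) = w − η·g(w + ρ·g(w,ω)/‖g(w,ω)‖, ω). Then E_ω[f(w⁺(ω))] ≤ f(w) − (η/2)·‖∇f(w)‖² + L·η²·σ² + (2 − L·η)·η·L²·ρ² + (1 − L·η)·η·L·G·ρ. (Lemma 3 of the paper.) -/

import Mathlib

open MeasureTheory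
open scoped RealInnerProductSpace

lemma descent_aux {d : ℕ}
    (f : EuclideanSpace ℝ (Fin d) → ℝ) (f' : EuclideanSpace ℝ (Fin d) → EuclideanSpace ℝ (Fin d))
    (L : ℝ) (hgrad : ∀ w, HasGradientAt f (f' w) w)
    (hsmooth : ∀ w v, ‖f' w - f' v‖ ≤ L * ‖w - v‖) (w v : EuclideanSpace ℝ (Fin d)) :
    f (w + v) ≤ f w + ⟪f' w, v⟫ + L / 2 * ‖v‖ ^ 2 := by
  have hder : ∀ t : ℝ, HasDerivAt
      (fun t : ℝ => f (w + t • v) - t * ⟪f' w, v⟫ - L / 2 * t ^ 2 * ‖v‖ ^ 2)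
      (⟪f' (w + t • v), v⟫ - ⟪f' w, v⟫ - L * t * ‖v‖ ^ 2) t := by
    intro t
    have h1 : HasDerivAt (fun t : ℝ => w + t • v) v t := by
      simpa using ((hasDerivAt_id t).smul_const v).const_add w
    have h2 := (hgrad (w + t • v)).hasFDerivAt.comp_hasDerivAt t h1
    have h3 : HasDerivAt (fun t : ℝ => t * ⟪f' w, v⟫) ⟪f' w, v⟫ t := by
      simpa using (hasDerivAt_id t).mul_const ⟪f' w, v⟫
    have h4 : HasDerivAt (fun t : ℝ => L / 2 * t ^ 2 * ‖v‖ ^ 2) (L * t * ‖v‖ ^ 2) t := by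
      have := ((hasDerivAt_pow 2 t).const_mul (L / 2)).mul_const (‖v‖ ^ 2)
      refine this.congr_deriv ?_
      push_cast
      ring
    have h5 := (h2.sub h3).sub h4
    refine HasDerivAt.congr_deriv h5 ?_
    simp
  have hanti := antitoneOn_of_deriv_nonpos (convex_Icc (0 : ℝ) 1)
    (fun t _ => (hder t).continuousAt.continuousWithinAt)
    (fun t _ => (hder t).differentiableAt.differentiableWithinAt)
    (by
      intro t ht
      rw [interior_Icc] at ht
      rw [(hder t).deriv, ← inner_sub_left]
      have h1 := real_inner_le_norm (f' (w + t • v) - f' w) v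
      have h2 := hsmooth (w + t • v) w
      rw [add_sub_cancel_left, norm_smul, Real.norm_eq_abs, abs_of_pos ht.1] at h2
      have h3 := mul_le_mul_of_nonneg_right h2 (norm_nonneg v)
      nlinarith)
  have := hanti (Set.left_mem_Icc.2 zero_le_one) (Set.right_mem_Icc.2 zero_le_one) zero_le_one
  simp at this
  linarith

/-- **Lemma 3.** For differentiable `f` with `G`-bounded gradient and `L`-smoothness, a
stochastic gradient oracle `g` with variance `σ²`, step size `0 < η ≤ 1/L` and radius `ρ > 0`,
the one-step SAM update `w⁺(ω) = w − η·g(w + ρ·g(w,ω)/‖g(w,ω)‖, ω)` satisfies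
`E_ω[f(w⁺(ω))] ≤ f(w) − (η/2)‖∇f(w)‖² + Lη²σ² + (2 − Lη)ηL²ρ² + (1 − Lη)ηLGρ`. -/
theorem lemma3_sam_descent {d : ℕ}
    {Ω : Type*} [MeasurableSpace Ω] (P : Measure Ω) [IsProbabilityMeasure P]
    (f : EuclideanSpace ℝ (Fin d) → ℝ) (f' : EuclideanSpace ℝ (Fin d) → EuclideanSpace ℝ (Fin d))
    (g : EuclideanSpace ℝ (Fin d) → Ω → EuclideanSpace ℝ (Fin d))
    (G L σ η ρ : ℝ) (hG : 0 ≤ G) (hL : 0 < L) (hη : 0 < η) (hηL : η ≤ 1 / L) (hρ : 0 < ρ)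
    (hgrad : ∀ w, HasGradientAt f (f' w) w)
    (hbound : ∀ w, ‖f' w‖ ≤ G)
    (hsmooth : ∀ w v, ‖f' w - f' v‖ ≤ L * ‖w - v‖)
    (hgmeas : Measurable fun p : EuclideanSpace ℝ (Fin d) × Ω => g p.1 p.2)
    (hglip : ∀ ω w v, ‖g w ω - g v ω‖ ≤ L * ‖w - v‖)
    (hgne : ∀ w ω, g w ω ≠ 0)
    (hgint : ∀ w, Integrable (fun ω => g w ω) P)
    (hunbiased : ∀ w, ∫ ω, g w ω ∂P = f' w)
    (hvarint : ∀ w, Integrable (fun ω => ‖g w ω - f' w‖ ^ 2) P)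
    (hvar : ∀ w, ∫ ω, ‖g w ω - f' w‖ ^ 2 ∂P ≤ σ ^ 2)
    (w : EuclideanSpace ℝ (Fin d)) (hw : f' w ≠ 0) :
    ∫ ω, f (w - η • g (w + ρ • ‖g w ω‖⁻¹ • g w ω) ω) ∂P
      ≤ f w - (η / 2) * ‖f' w‖ ^ 2 + L * η ^ 2 * σ ^ 2
        + (2 - L * η) * η * L ^ 2 * ρ ^ 2 + (1 - L * η) * η * L * G * ρ := by
  have hLη : L * η ≤ 1 := by
    have := (le_div_iff₀ hL).1 hηL
    linarith
  set h : Ω → EuclideanSpace ℝ (Fin d) := fun ω => g (w + ρ • ‖g w ω‖⁻¹ • g w ω) ω with hh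
  have hg0m : Measurable (fun ω => g w ω) := hgmeas.comp (measurable_const.prodMk measurable_id)
  have hhm : Measurable h := by
    have : Measurable (fun ω => (w + ρ • ‖g w ω‖⁻¹ • g w ω, ω)) := by
      refine Measurable.prodMk ?_ measurable_id
      exact measurable_const.add ((hg0m.norm.inv.smul hg0m).const_smul ρ)
    exact hgmeas.comp this
  have hu : ∀ ω, ‖h ω - g w ω‖ ≤ L * ρ := by
    intro ω
    have h1 := hglip ω (w + ρ • ‖g w ω‖⁻¹ • g w ω) w
    rw [add_sub_cancel_left, norm_smul, norm_smul, norm_inv, norm_norm,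
      inv_mul_cancel₀ (norm_ne_zero_iff.2 (hgne w ω)), Real.norm_eq_abs, abs_of_pos hρ,
      mul_one] at h1
    exact h1
  have hfc : Continuous f := continuous_iff_continuousAt.2 fun x => (hgrad x).continuousAt
  have hflip : ∀ x y, ‖f y - f x‖ ≤ G * ‖y - x‖ := by
    intro x y
    refine Convex.norm_image_sub_le_of_norm_hasFDerivWithin_le (s := Set.univ)
      (fun z _ => (hgrad z).hasFDerivAt.hasFDerivWithinAt) (fun z _ => ?_) convex_univ
      (Set.mem_univ _) (Set.mem_univ _)
    simpa using hbound z
  have hhint : Integrable h P := by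
    refine Integrable.mono' ((hgint w).norm.add (integrable_const (L * ρ)))
      hhm.aestronglyMeasurable (Filter.Eventually.of_forall fun ω => ?_)
    have h1 := norm_add_le (g w ω) (h ω - g w ω)
    rw [add_sub_cancel] at h1
    have h2 := hu ω
    simp only [Pi.add_apply]
    linarith
  have hFint : Integrable (fun ω => f (w - η • h ω)) P := by
    refine Integrable.mono' ((integrable_const (|f w|)).add (hhint.norm.const_mul (G * η)))
      (hfc.measurable.comp (measurable_const.sub (hhm.const_smul η))).aestronglyMeasurable
      (Filter.Eventually.of_forall fun ω => ?_)
    have h1 := hflip w (w - η • h ω)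
    rw [sub_sub_cancel_left, norm_neg, norm_smul, Real.norm_eq_abs, Real.norm_eq_abs,
      abs_of_pos hη] at h1
    have h2 := abs_add_le (f w) (f (w - η • h ω) - f w)
    rw [add_sub_cancel] at h2
    simp only [Pi.add_apply, Real.norm_eq_abs]
    linarith
  have hpt : ∀ ω, f (w - η • h ω) ≤ (f w - L * η ^ 2 / 2 * ‖f' w‖ ^ 2 + L * η ^ 2 * (L ^ 2 * ρ ^ 2)
      + (η - L * η ^ 2) * (G * (L * ρ))) + L * η ^ 2 * ‖g w ω - f' w‖ ^ 2
      - (η - L * η ^ 2) * ⟪f' w, g w ω⟫ := by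
    intro ω
    have h1 := descent_aux f f' L hgrad hsmooth w (-(η • h ω))
    rw [← sub_eq_add_neg, inner_neg_right, inner_smul_right, norm_neg, norm_smul,
      Real.norm_eq_abs, abs_of_pos hη] at h1
    have h2 : ‖h ω - f' w‖ ^ 2 = ‖h ω‖ ^ 2 - 2 * ⟪f' w, h ω⟫ + ‖f' w‖ ^ 2 := by
      rw [norm_sub_sq_real, real_inner_comm]
    have h3 : ‖h ω - f' w‖ ^ 2 ≤ 2 * (L ^ 2 * ρ ^ 2) + 2 * ‖g w ω - f' w‖ ^ 2 := by
      have a := norm_add_le (h ω - g w ω) (g w ω - f' w)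
      rw [sub_add_sub_cancel] at a
      have b := hu ω
      have c : ‖h ω - f' w‖ ^ 2 ≤ (L * ρ + ‖g w ω - f' w‖) ^ 2 :=
        pow_le_pow_left₀ (norm_nonneg _) (by linarith) 2
      nlinarith [sq_nonneg (L * ρ - ‖g w ω - f' w‖)]
    have h4 : ⟪f' w, g w ω⟫ - G * (L * ρ) ≤ ⟪f' w, h ω⟫ := by
      have a := (abs_le.1 (abs_real_inner_le_norm (f' w) (h ω - g w ω))).1
      have b : ‖f' w‖ * ‖h ω - g w ω‖ ≤ G * (L * ρ) :=
        mul_le_mul (hbound w) (hu ω) (norm_nonneg _) hG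
      rw [inner_sub_right] at a
      linarith
    have h5 : 0 ≤ η - L * η ^ 2 := by nlinarith
    have h6 := mul_le_mul_of_nonneg_left h4 h5
    have h7 := mul_le_mul_of_nonneg_left h3 (by positivity : 0 ≤ L * η ^ 2 / 2)
    rw [h2] at h7
    nlinarith
  have hI1 : Integrable (fun ω => L * η ^ 2 * ‖g w ω - f' w‖ ^ 2) P := (hvarint w).const_mul _
  have hI2 : Integrable (fun ω => (η - L * η ^ 2) * ⟪f' w, g w ω⟫) P :=
    ((hgint w).const_inner (f' w)).const_mul _
  have hint := integral_mono hFint (((integrable_const _).add hI1).sub hI2) hpt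
  have hin : ∫ ω, ⟪f' w, g w ω⟫ ∂P = ‖f' w‖ ^ 2 := by
    rw [integral_inner (hgint w), hunbiased, real_inner_self_eq_norm_sq]
  rw [integral_sub' ((integrable_const _).add hI1) hI2, integral_add' (integrable_const _) hI1,
    integral_const_mul, integral_const_mul, hin] at hint
  simp only [integral_const, probReal_univ, one_smul] at hint
  refine hint.trans ?_
  have h1 := mul_le_mul_of_nonneg_left (hvar w) (by positivity : 0 ≤ L * η ^ 2)
  have h2 : 0 ≤ (1 - L * η) * (η * ‖f' w‖ ^ 2) :=
    mul_nonneg (by linarith) (by positivity)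
  have h3 : 0 ≤ (1 - L * η) * (η * L ^ 2 * ρ ^ 2) :=
    mul_nonneg (by linarith) (by positivity)
  nlinarith
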